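/- Let E = {f_1, ..., f_k} be a set of k pairwise orthogonal unit vectors in an n-dimensional real inner product space V, and let H be the hyperplane arrangement consisting of the k hyperplanes orthogonal to the f_i. Let a be a point of V with ‖a‖ ≤ 1. Then the alternating sum over chambers T of H of (-1)^T times Vol(B(a,1) ∩ T) (where (-1)^T is (-1) to the number of hyperplanes separating T from the base chamber on the positive side of all f_i) equals 2^k · β_{n-k} · ∫_0^{⟨f_1,a⟩} ⋯ ∫_0^{⟨f_k,a⟩} (1 - t_1² - ⋯ - t_k²)^{(n-k)/2} dt_1 ⋯ dt_k, where β_m = π^{m/2}/Γ(m/2+1) is the volume of the m-dimensional unit ball. -/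

import Mathlib

open MeasureTheory Finset
open scoped RealInnerProductSpace

/-- The volume of the `m`-dimensional unit ball: `π^{m/2} / Γ(m/2 + 1)`. -/
noncomputable def unitBallVol (m : ℕ) : ℝ :=
  Real.pi ^ ((m : ℝ) / 2) / Real.Gamma ((m : ℝ) / 2 + 1)

/-- Negate the coordinates selected by `s`. -/
def flipCoord {ι : Type*} (s : ι → Bool) (u : ι → ℝ) : ι → ℝ :=
  fun i => if s i then -u i else u i

theorem flipCoord_involutive {ι : Type*} (s : ι → Bool) :
    Function.Involutive (flipCoord s) := by
  intro u
  ext i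
  unfold flipCoord
  split_ifs <;> simp

theorem measurePreserving_flipCoord {ι : Type*} [Fintype ι] (s : ι → Bool) :
    MeasurePreserving (flipCoord s) volume volume := by
  refine volume_preserving_pi (f := fun i (t : ℝ) => if s i then -t else t) fun i => ?_
  cases s i
  · exact MeasurePreserving.id (volume : Measure ℝ)
  · simpa using Measure.measurePreserving_neg (volume : Measure ℝ)

theorem integral_flipCoord {ι : Type*} [Fintype ι] (s : ι → Bool) (h : (ι → ℝ) → ℝ) :
    ∫ u, h (flipCoord s u) = ∫ u, h u :=
  (measurePreserving_flipCoord s).integral_comp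
    (MeasurableEquiv.ofInvolutive (flipCoord s) (flipCoord_involutive s)
      (measurePreserving_flipCoord s).measurable).measurableEmbedding h

theorem integral_mul_prod_add_neg {ι : Type*} [Fintype ι] {g : (ι → ℝ) → ℝ}
    (hg : ∀ s u, g (flipCoord s u) = g u) {φ : ι → ℝ → ℝ}
    (hint : Integrable fun u : ι → ℝ => g u * ∏ i, φ i (u i)) :
    ∫ u : ι → ℝ, g u * ∏ i, (φ i (u i) + φ i (-u i)) =
      2 ^ Fintype.card ι * ∫ u : ι → ℝ, g u * ∏ i, φ i (u i) := by
  classical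
  have key : ∀ u : ι → ℝ, g u * ∏ i, (φ i (u i) + φ i (-u i)) =
      ∑ s : ι → Bool, g (flipCoord s u) * ∏ i, φ i (flipCoord s u i) := by
    intro u
    simp_rw [hg, ← Finset.mul_sum]
    congr 1
    have := Fintype.prod_sum fun i (c : Bool) => φ i (if c then -u i else u i)
    simpa [add_comm, flipCoord] using this
  simp_rw [key]
  rw [integral_finsetSum]
  · simp_rw [integral_flipCoord _ fun u => g u * ∏ i, φ i (u i)]
    simp
  · intro s _
    exact (measurePreserving_flipCoord s).integrable_comp_of_integrable hint

theorem integral_mul_prod_congr_of_even_part {ι : Type*} [Fintype ι] {g : (ι → ℝ) → ℝ}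
    (hg : ∀ s u, g (flipCoord s u) = g u) {φ ψ : ι → ℝ → ℝ}
    (hφ : Integrable fun u : ι → ℝ => g u * ∏ i, φ i (u i))
    (hψ : Integrable fun u : ι → ℝ => g u * ∏ i, ψ i (u i))
    (h : ∀ i, ∀ᵐ t : ℝ, φ i t + φ i (-t) = ψ i t + ψ i (-t)) :
    ∫ u : ι → ℝ, g u * ∏ i, φ i (u i) = ∫ u : ι → ℝ, g u * ∏ i, ψ i (u i) := by
  have h2 : (2 : ℝ) ^ Fintype.card ι ≠ 0 := by positivity
  refine mul_left_cancel₀ h2 ?_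
  rw [← integral_mul_prod_add_neg hg hφ, ← integral_mul_prod_add_neg hg hψ]
  refine integral_congr_ae ?_
  have h' : ∀ᵐ u : ι → ℝ, ∀ i, φ i (u i) + φ i (-u i) = ψ i (u i) + ψ i (-u i) :=
    ae_all_iff.2 fun i =>
      (Measure.quasiMeasurePreserving_eval (fun _ : ι => (volume : Measure ℝ)) i).ae (h i)
  filter_upwards [h'] with u hu
  simp_rw [hu]

theorem volume_real_sum_sq_le (d : ℕ) (r : ℝ) :
    volume.real {y : Fin d → ℝ | ∑ i, y i ^ 2 ≤ r} =
      if 0 ≤ r then unitBallVol d * r ^ ((d : ℝ) / 2) else 0 := by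
  split_ifs with hr
  · rcases Nat.eq_zero_or_pos d with rfl | hd
    · simp [hr, unitBallVol, Measure.real, volume_pi]
    · have : Nonempty (Fin d) := ⟨⟨0, hd⟩⟩
      have hset : (@WithLp.ofLp 2 (Fin d → ℝ)) ⁻¹' {y : Fin d → ℝ | ∑ i, y i ^ 2 ≤ r} =
          Metric.closedBall 0 (√r) := by
        ext y
        simp [EuclideanSpace.norm_eq, Real.sqrt_le_sqrt_iff hr]
      have hm : MeasurableSet {y : Fin d → ℝ | ∑ i, y i ^ 2 ≤ r} :=
        measurableSet_le (by fun_prop) measurable_const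
      rw [Measure.real, ← (PiLp.volume_preserving_ofLp (Fin d)).measure_preimage
        hm.nullMeasurableSet, hset, EuclideanSpace.volume_closedBall]
      rw [← ENNReal.ofReal_pow (Real.sqrt_nonneg _), ← ENNReal.ofReal_mul (by positivity),
        ENNReal.toReal_ofReal (by positivity), unitBallVol, mul_comm]
      have e1 : √r ^ Fintype.card (Fin d) = r ^ ((d : ℝ) / 2) := by
        rw [Fintype.card_fin, Real.sqrt_eq_rpow, ← Real.rpow_mul_natCast hr]
        congr 1
        ring
      have e2 : √Real.pi ^ Fintype.card (Fin d) = Real.pi ^ ((d : ℝ) / 2) := by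
        rw [Fintype.card_fin, Real.sqrt_eq_rpow, ← Real.rpow_mul_natCast Real.pi_pos.le]
        congr 1
        ring
      rw [e1, e2, Fintype.card_fin]
  · have : {y : Fin d → ℝ | ∑ i, y i ^ 2 ≤ r} = ∅ := by
      ext y
      simp only [Set.mem_ofPred_eq, Set.mem_empty_iff_false, iff_false]
      have := Finset.sum_nonneg fun i (_ : i ∈ Finset.univ) => sq_nonneg (y i)
      linarith
    simp [this]

theorem exists_orthonormalBasis_extending {n k : ℕ} (hkn : k ≤ n)
    {f : Fin k → EuclideanSpace ℝ (Fin n)} (hf : Orthonormal ℝ f) :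
    ∃ b : OrthonormalBasis (Fin k ⊕ Fin (n - k)) ℝ (EuclideanSpace ℝ (Fin n)),
      ∀ i, b (Sum.inl i) = f i := by
  have hcard : Module.finrank ℝ (EuclideanSpace ℝ (Fin n)) =
      Fintype.card (Fin k ⊕ Fin (n - k)) := by
    simp [hkn]
  have hv : Orthonormal ℝ ((Set.range Sum.inl).domRestrict
      (Sum.elim f fun _ : Fin (n - k) => 0)) := by
    have := hf.comp (Equiv.ofInjective (Sum.inl : Fin k → Fin k ⊕ Fin (n - k))
      Sum.inl_injective).symm (Equiv.injective _)
    convert! this using 1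
    ext ⟨_, i, rfl⟩ : 1
    simp
  obtain ⟨b, hb⟩ := hv.exists_orthonormalBasis_extension_of_card_eq hcard
  exact ⟨b, fun i => by simpa using hb _ ⟨i, rfl⟩⟩

theorem setIntegral_closedBall_orthonormal {n k : ℕ} (hkn : k ≤ n)
    {f : Fin k → EuclideanSpace ℝ (Fin n)} (hf : Orthonormal ℝ f)
    {H : (Fin k → ℝ) → ℝ} (hH : Measurable H) {C : ℝ} (hC : ∀ u, ‖H u‖ ≤ C) :
    ∫ x in Metric.closedBall 0 1, H (fun i => ⟪f i, x⟫) =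
      ∫ u, volume.real {y : Fin (n - k) → ℝ | ∑ i, y i ^ 2 ≤ 1 - ∑ i, u i ^ 2} * H u := by
  obtain ⟨b, hb⟩ := exists_orthonormalBasis_extending hkn hf
  let S : Set ((Fin k → ℝ) × (Fin (n - k) → ℝ)) := {p | ∑ i, p.2 i ^ 2 ≤ 1 - ∑ i, p.1 i ^ 2}
  have hS : MeasurableSet S := measurableSet_le (by fun_prop) (by fun_prop)
  let e : EuclideanSpace ℝ (Fin n) ≃ᵐ (Fin k → ℝ) × (Fin (n - k) → ℝ) :=
    b.measurableEquiv.trans ((MeasurableEquiv.toLp 2 (Fin k ⊕ Fin (n - k) → ℝ)).symm.trans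
      (MeasurableEquiv.sumPiEquivProdPi fun _ => ℝ))
  have he : MeasurePreserving e volume volume :=
    (volume_measurePreserving_sumPiEquivProdPi fun _ => ℝ).comp
      ((EuclideanSpace.volume_preserving_symm_measurableEquiv_toLp _).comp
        b.measurePreserving_measurableEquiv)
  have he1 : ∀ x i, (e x).1 i = ⟪f i, x⟫ := by
    intro x i
    rw [← hb, ← b.repr_apply_apply]
    rfl
  have hpre : e ⁻¹' S = Metric.closedBall 0 1 := by
    ext x
    have hx : ‖x‖ ^ 2 = ∑ i, (e x).1 i ^ 2 + ∑ i, (e x).2 i ^ 2 := by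
      rw [← b.repr.norm_map, EuclideanSpace.norm_sq_eq, Fintype.sum_sum_type]
      simp only [Real.norm_eq_abs, sq_abs]
      rfl
    rw [mem_closedBall_zero_iff, ← sq_le_one_iff₀ (norm_nonneg x), hx]
    change ∑ i, (e x).2 i ^ 2 ≤ 1 - ∑ i, (e x).1 i ^ 2 ↔ _
    rw [le_sub_iff_add_le, add_comm]
  have hfin : volume S ≠ ⊤ := by
    rw [← he.measure_preimage hS.nullMeasurableSet, hpre]
    exact (isCompact_closedBall _ _).measure_lt_top.ne
  have hint : IntegrableOn (fun p : (Fin k → ℝ) × (Fin (n - k) → ℝ) => H p.1) S :=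
    Measure.integrableOn_of_bounded hfin (hH.comp measurable_fst).aestronglyMeasurable
      (ae_of_all _ fun p => hC p.1)
  calc ∫ x in Metric.closedBall 0 1, H (fun i => ⟪f i, x⟫)
      = ∫ x in e ⁻¹' S, H (e x).1 := by
        rw [hpre]
        simp_rw [← he1]
    _ = ∫ p in S, H p.1 := he.setIntegral_preimage_emb e.measurableEmbedding (fun p => H p.1) S
    _ = ∫ p, S.indicator (fun p => H p.1) p := (integral_indicator hS).symm
    _ = ∫ u, ∫ y, S.indicator (fun p => H p.1) (u, y) :=
        integral_prod _ ((integrable_indicator_iff hS).2 hint)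
    _ = _ := by
        refine integral_congr_ae (ae_of_all _ fun u => ?_)
        have hm : MeasurableSet {y : Fin (n - k) → ℝ | ∑ i, y i ^ 2 ≤ 1 - ∑ i, u i ^ 2} :=
          measurableSet_le (by fun_prop) (by fun_prop)
        have : (fun y => S.indicator (fun p => H p.1) (u, y)) =
            {y : Fin (n - k) → ℝ | ∑ i, y i ^ 2 ≤ 1 - ∑ i, u i ^ 2}.indicator fun _ => H u := by
          ext y
          rfl
        simp only [this]
        rw [integral_indicator hm, setIntegral_const, smul_eq_mul]

theorem measurable_real_sign : Measurable Real.sign :=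
  Measurable.ite measurableSet_Iio measurable_const
    (Measurable.ite measurableSet_Ioi measurable_const measurable_const)

theorem norm_real_sign_le_one (t : ℝ) : ‖Real.sign t‖ ≤ 1 := by
  rcases Real.sign_apply_eq t with h | h | h <;> simp [h]

theorem norm_prod_real_sign_le_one {ι : Type*} [Fintype ι] (u : ι → ℝ) :
    ‖∏ i, Real.sign (u i)‖ ≤ 1 := by
  rw [norm_prod]
  exact Finset.prod_le_one (fun _ _ => norm_nonneg _) fun _ _ => norm_real_sign_le_one _

theorem sum_neg_one_pow_mul_volume_chamber {E : Type*} [NormedAddCommGroup E]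
    [InnerProductSpace ℝ E] [MeasurableSpace E] [BorelSpace E]
    [SecondCountableTopology E] (μ : Measure E)
    {ι : Type*} [Fintype ι] [DecidableEq ι] (f : ι → E) {K : Set E} (hK : μ K ≠ ⊤) :
    ∑ s : ι → Bool, (-1 : ℝ) ^ (Finset.univ.filter fun i => s i = true).card *
        μ.real (K ∩ {x : E | ∀ i, if s i then ⟪f i, x⟫ ≤ 0 else 0 ≤ ⟪f i, x⟫}) =
      ∫ x in K, ∏ i, Real.sign ⟪f i, x⟫ ∂μ := by
  let c : Bool → ℝ → ℝ := fun b t => if b then (if t ≤ 0 then -1 else 0) else (if 0 ≤ t then 1 else 0)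
  have hsign : ∀ t, Real.sign t = ∑ b, c b t := by
    intro t
    simp only [Fintype.sum_bool, c, Real.sign]
    grind
  have hc : ∀ (s : ι → Bool) (x : E), ∏ i, c (s i) ⟪f i, x⟫ =
      {x : E | ∀ i, if s i then ⟪f i, x⟫ ≤ 0 else 0 ≤ ⟪f i, x⟫}.indicator
        (fun _ => (-1 : ℝ) ^ (Finset.univ.filter fun i => s i = true).card) x := by
    intro s x
    by_cases hx : ∀ i, if s i then ⟪f i, x⟫ ≤ 0 else 0 ≤ ⟪f i, x⟫
    · rw [Set.indicator_of_mem (by exact hx), ← Finset.prod_const, Finset.prod_filter]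
      refine Finset.prod_congr rfl fun i _ => ?_
      have := hx i
      simp only [c]
      split_ifs at * <;> simp_all
    · rw [Set.indicator_of_notMem (by exact hx)]
      push Not at hx
      obtain ⟨i, hi⟩ := hx
      refine Finset.prod_eq_zero (Finset.mem_univ i) ?_
      simp only [c]
      split_ifs at * <;> simp_all
  have hmeas : ∀ s : ι → Bool,
      MeasurableSet {x : E | ∀ i, if s i then ⟪f i, x⟫ ≤ 0 else 0 ≤ ⟪f i, x⟫} := by
    intro s
    simp only [Set.ofPred_forall]
    refine MeasurableSet.iInter fun i => ?_
    cases s i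
    · simpa using measurableSet_le measurable_const (by fun_prop)
    · simpa using measurableSet_le (by fun_prop) measurable_const
  simp_rw [hsign, Fintype.prod_sum, hc]
  rw [integral_finsetSum]
  · refine Finset.sum_congr rfl fun s _ => ?_
    rw [integral_indicator (hmeas s), Measure.restrict_restrict (hmeas s), setIntegral_const,
      smul_eq_mul, mul_comm, Set.inter_comm]
  · intro s _
    have : IsFiniteMeasure (μ.restrict K) := ⟨by simpa using hK.lt_top⟩
    exact (integrable_const _).indicator (hmeas s)

theorem real_sign_add_even_part {b t : ℝ} (h0 : t ≠ 0) (hb : t ≠ b) (hb' : t ≠ -b) :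
    Real.sign (b + t) + Real.sign (b + -t) =
      2 * (if b < 0 then -1 else 1) * (Set.uIoc 0 b).indicator 1 t +
        2 * (if b < 0 then -1 else 1) * (Set.uIoc 0 b).indicator 1 (-t) := by
  classical
  simp only [Real.sign, Set.indicator_apply, Set.mem_uIoc, Pi.one_apply]
  grind

/-- the pizza quantity of the arrangement `A_1^k` of the `k` hyperplanes
orthogonal to an orthonormal family `f : Fin k → V` in `n`-dimensional space, for a unit
ball `B(a,1)`, equals `2^k · β_{n-k} · ∫_0^{⟨f_1,a⟩} ⋯ ∫_0^{⟨f_k,a⟩}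
(1 - t_1² - ⋯ - t_k²)^{(n-k)/2} dt`.  The chambers are indexed by sign vectors
`s : Fin k → Bool`, with sign `(-1)` to the number of separating hyperplanes, and the
signed iterated integral is written as an integral over the box `∏ [0, ⟨f_i,a⟩]`
(oriented, i.e. multiplied by the sign of each `⟨f_i,a⟩`). -/
theorem pizza_A1k_integral (n k : ℕ) (hkn : k ≤ n)
    (f : Fin k → EuclideanSpace ℝ (Fin n)) (hf : Orthonormal ℝ f)
    (a : EuclideanSpace ℝ (Fin n)) (ha : ‖a‖ ≤ 1) :
    (∑ s : Fin k → Bool,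
      (-1 : ℝ) ^ (Finset.univ.filter fun i => s i = true).card *
        (volume (Metric.closedBall a 1 ∩
          {x : EuclideanSpace ℝ (Fin n) |
            ∀ i, if s i then ⟪f i, x⟫ ≤ 0 else 0 ≤ ⟪f i, x⟫})).toReal) =
    2 ^ k * unitBallVol (n - k) *
      ((∏ i : Fin k, if ⟪f i, a⟫ < 0 then (-1 : ℝ) else 1) *
        ∫ t in Set.univ.pi fun i : Fin k => Set.uIoc 0 ⟪f i, a⟫,
          (1 - ∑ i, t i ^ 2) ^ (((n : ℝ) - (k : ℝ)) / 2)) := by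
  let b : Fin k → ℝ := fun i => ⟪f i, a⟫
  let g : (Fin k → ℝ) → ℝ := fun u =>
    volume.real {y : Fin (n - k) → ℝ | ∑ i, y i ^ 2 ≤ 1 - ∑ i, u i ^ 2}
  let φ : Fin k → ℝ → ℝ := fun i t => Real.sign (b i + t)
  let ψ : Fin k → ℝ → ℝ := fun i t =>
    2 * (if b i < 0 then -1 else 1) * (Set.uIoc 0 (b i)).indicator 1 t
  let B : Set (Fin k → ℝ) := Set.univ.pi fun i => Set.uIoc 0 (b i)
  have hB : MeasurableSet B := MeasurableSet.univ_pi fun i => measurableSet_uIoc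
  have hg : ∀ u, g u = if 0 ≤ 1 - ∑ i, u i ^ 2 then
      unitBallVol (n - k) * (1 - ∑ i, u i ^ 2) ^ (((n - k : ℕ) : ℝ) / 2) else 0 :=
    fun u => volume_real_sum_sq_le (n - k) _
  have hgflip : ∀ s u, g (flipCoord s u) = g u := by
    intro s u
    have : ∀ i, flipCoord s u i ^ 2 = u i ^ 2 := by
      intro i
      unfold flipCoord
      split_ifs <;> simp
    simp only [g, this]
  have hgm : Measurable g := by
    rw [funext hg]
    exact Measurable.ite (measurableSet_le (by fun_prop) (by fun_prop)) (by fun_prop) (by fun_prop)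
  have hβ : 0 ≤ unitBallVol (n - k) := by
    unfold unitBallVol
    have : 0 < Real.Gamma (((n - k : ℕ) : ℝ) / 2 + 1) := Real.Gamma_pos_of_pos (by positivity)
    positivity
  have hgint : Integrable g := by
    have hD : MeasurableSet {u : Fin k → ℝ | ∑ i, u i ^ 2 ≤ 1} :=
      measurableSet_le (by fun_prop) (by fun_prop)
    have hDfin : volume {u : Fin k → ℝ | ∑ i, u i ^ 2 ≤ 1} ≠ ⊤ := by
      refine measure_ne_top_of_subset ?_
        (isCompact_closedBall (0 : Fin k → ℝ) 1).measure_lt_top.ne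
      intro u hu
      rw [mem_closedBall_zero_iff, pi_norm_le_iff_of_nonneg zero_le_one]
      intro i
      rw [Real.norm_eq_abs, ← sq_le_one_iff_abs_le_one]
      exact (Finset.single_le_sum (fun j _ => sq_nonneg (u j)) (Finset.mem_univ i)).trans hu
    have hon : IntegrableOn g {u : Fin k → ℝ | ∑ i, u i ^ 2 ≤ 1} := by
      refine Measure.integrableOn_of_bounded (M := unitBallVol (n - k)) hDfin
        hgm.aestronglyMeasurable (ae_of_all _ fun u => ?_)
      rw [hg]
      split_ifs with h
      · rw [Real.norm_of_nonneg (by positivity)]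
        refine mul_le_of_le_one_right hβ (Real.rpow_le_one h ?_ (by positivity))
        linarith [Finset.sum_nonneg fun i (_ : i ∈ Finset.univ) => sq_nonneg (u i)]
      · simpa using hβ
    rwa [integrableOn_iff_integrable_of_support_subset] at hon
    intro u hu
    by_contra h
    refine hu ?_
    rw [hg, if_neg]
    intro h'
    exact h (show ∑ i, u i ^ 2 ≤ 1 by linarith)
  have hψ : ∀ u : Fin k → ℝ, ∏ i, ψ i (u i) =
      2 ^ k * (∏ i, if b i < 0 then (-1 : ℝ) else 1) * B.indicator 1 u := by
    intro u
    have : ∏ i, (Set.uIoc 0 (b i)).indicator (1 : ℝ → ℝ) (u i) = B.indicator 1 u := by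
      classical
      simp only [Set.indicator_apply, Pi.one_apply, Finset.prod_ite_zero, B, Set.mem_univ_pi,
        Finset.mem_univ, true_imp_iff, Finset.prod_const_one]
    simp only [ψ, Finset.prod_mul_distrib, this, Finset.prod_const, Finset.card_univ,
      Fintype.card_fin]
  have hφm : Measurable fun u : Fin k → ℝ => ∏ i, φ i (u i) :=
    Finset.measurable_prod _ fun i _ => measurable_real_sign.comp (by fun_prop)
  have hφint : Integrable fun u : Fin k → ℝ => g u * ∏ i, φ i (u i) :=
    hgint.mul_bdd hφm.aestronglyMeasurable
      (ae_of_all _ fun u => norm_prod_real_sign_le_one fun i => b i + u i)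
  have hψeq : (fun u : Fin k → ℝ => g u * ∏ i, ψ i (u i)) = fun u =>
      2 ^ k * (∏ i, if b i < 0 then (-1 : ℝ) else 1) * B.indicator g u := by
    ext u
    rw [hψ]
    by_cases hu : u ∈ B <;> simp [hu, mul_comm]
  have hψint : Integrable fun u : Fin k → ℝ => g u * ∏ i, ψ i (u i) := by
    rw [hψeq]
    exact (hgint.indicator hB).const_mul _
  have heven : ∀ i, ∀ᵐ t : ℝ, φ i t + φ i (-t) = ψ i t + ψ i (-t) := by
    intro i
    filter_upwards [Measure.ae_ne volume 0, Measure.ae_ne volume (b i),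
      Measure.ae_ne volume (-b i)] with t h0 hb hb'
    exact real_sign_add_even_part h0 hb hb'
  have hb : ∑ i, b i ^ 2 ≤ 1 := by
    have h := hf.sum_inner_products_le a (s := Finset.univ)
    simp only [Real.norm_eq_abs, sq_abs] at h
    exact h.trans (pow_le_one₀ (norm_nonneg a) ha)
  have hBg : ∀ u ∈ B, g u =
      unitBallVol (n - k) * (1 - ∑ i, u i ^ 2) ^ (((n : ℝ) - (k : ℝ)) / 2) := by
    intro u hu
    have hub : ∑ i, u i ^ 2 ≤ ∑ i, b i ^ 2 := by
      refine Finset.sum_le_sum fun i _ => sq_le_sq.2 ?_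
      have := Set.mem_uIoc.1 (hu i (Set.mem_univ i))
      grind
    rw [hg, if_pos (by linarith), Nat.cast_sub hkn]
  calc _ = ∫ x in Metric.closedBall a 1, ∏ i, Real.sign ⟪f i, x⟫ :=
        sum_neg_one_pow_mul_volume_chamber volume f (isCompact_closedBall a 1).measure_lt_top.ne
    _ = ∫ x in Metric.closedBall 0 1, ∏ i, φ i ⟪f i, x⟫ := by
        have hpre : (fun x => a + x) ⁻¹' Metric.closedBall a 1 = Metric.closedBall 0 1 := by
          ext x
          simp
        rw [← (measurePreserving_add_left volume a).setIntegral_preimage_emb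
          (measurableEmbedding_addLeft a), hpre]
        simp_rw [inner_add_right]
        rfl
    _ = ∫ u, g u * ∏ i, φ i (u i) :=
        setIntegral_closedBall_orthonormal hkn hf hφm
          fun u => norm_prod_real_sign_le_one fun i => b i + u i
    _ = ∫ u, g u * ∏ i, ψ i (u i) :=
        integral_mul_prod_congr_of_even_part hgflip hφint hψint heven
    _ = 2 ^ k * (∏ i, if b i < 0 then (-1 : ℝ) else 1) * ∫ u in B, g u := by
        rw [hψeq, integral_const_mul, integral_indicator hB]
    _ = _ := by
        rw [setIntegral_congr_fun hB hBg, integral_const_mul]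
        ring
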